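/- arXiv:1402.2708 — 3 statements merged into one kernel-verified Lean document; each statement's English description precedes it below -/
import Mathlib

section
/- Every socially optimal profile is a Nash equilibrium, i.e., Π_SO ⊆ Π_NE: if a jointly feasible profile σ̄ = (σ̄_1,…,σ̄_N) is a social (Pareto) optimum, then σ̄ is a Nash equilibrium. -/
/-- Player `i`'s strategy `si` is feasible against the other players' strategies in
profile `σ`: it satisfies the task specification `Φ i` and is compatible with every
other player's strategy. -/
def FeasibleAgainst {N : ℕ} {S : Fin N → Type*} (Φ : ∀ i, Set (S i))
    (Compat : ∀ i j, S i → S j → Prop) (i : Fin N) (si : S i) (σ : ∀ j, S j) : Prop :=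
  si ∈ Φ i ∧ ∀ j, j ≠ i → Compat i j si (σ j)

/-- A profile is jointly feasible if each player's strategy is feasible against the
others'. -/
def JointlyFeasible {N : ℕ} {S : Fin N → Type*} (Φ : ∀ i, Set (S i))
    (Compat : ∀ i j, S i → S j → Prop) (σ : ∀ j, S j) : Prop :=
  ∀ i, FeasibleAgainst Φ Compat i (σ i) σ

/-- Strict componentwise (Pareto) order on `ℝ^p`: `a ≺ b` iff `a ⪯ b` componentwise
and `a ≠ b`. -/
def ParetoLt {p : ℕ} (a b : Fin p → ℝ) : Prop :=
  (∀ ℓ, a ℓ ≤ b ℓ) ∧ a ≠ b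

/-- A jointly feasible profile `σbar` is a Nash equilibrium if no player has a feasible
unilateral deviation with strictly (Pareto) smaller cost. -/
def NashEquilibrium {N p : ℕ} {S : Fin N → Type*} (Φ : ∀ i, Set (S i))
    (Compat : ∀ i j, S i → S j → Prop) (Cost : ∀ i, S i → Fin p → ℝ)
    (σbar : ∀ j, S j) : Prop :=
  JointlyFeasible Φ Compat σbar ∧
    ∀ i, ¬ ∃ si : S i, FeasibleAgainst Φ Compat i si σbar ∧
      ParetoLt (Cost i si) (Cost i (σbar i))

/-- A jointly feasible profile `σbar` is a social (Pareto) optimum if no jointly feasible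
profile has strictly (Pareto) smaller total cost. -/
def SocialOptimum {N p : ℕ} {S : Fin N → Type*} (Φ : ∀ i, Set (S i))
    (Compat : ∀ i j, S i → S j → Prop) (Cost : ∀ i, S i → Fin p → ℝ)
    (σbar : ∀ j, S j) : Prop :=
  JointlyFeasible Φ Compat σbar ∧
    ¬ ∃ σ : ∀ j, S j, JointlyFeasible Φ Compat σ ∧
      ParetoLt (∑ i, Cost i (σ i)) (∑ i, Cost i (σbar i))

theorem paretoLt_iff_lt {p : ℕ} {a b : Fin p → ℝ} : ParetoLt a b ↔ a < b :=
  (lt_iff_le_and_ne (a := a) (b := b)).symm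

/-- A feasible unilateral deviation from a jointly feasible profile yields a jointly feasible
profile, provided that compatibility is symmetric. -/
theorem JointlyFeasible.update {N : ℕ} {S : Fin N → Type*} {Φ : ∀ i, Set (S i)}
    {Compat : ∀ i j, S i → S j → Prop}
    (hsym : ∀ i j, i ≠ j → ∀ (si : S i) (sj : S j), Compat i j si sj ↔ Compat j i sj si)
    {σ : ∀ j, S j} (hσ : JointlyFeasible Φ Compat σ) {i : Fin N} {si : S i}
    (hsi : FeasibleAgainst Φ Compat i si σ) :
    JointlyFeasible Φ Compat (Function.update σ i si) := by
  intro k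
  rcases eq_or_ne k i with rfl | hk
  · refine ⟨by simpa using hsi.1, fun j hj => ?_⟩
    simpa [Function.update_of_ne hj] using hsi.2 j hj
  · rw [Function.update_of_ne hk]
    refine ⟨(hσ k).1, fun j hj => ?_⟩
    rcases eq_or_ne j i with rfl | hji
    · simpa using (hsym j k hk.symm si (σ k)).1 (hsi.2 k hk)
    · simpa [Function.update_of_ne hji] using (hσ k).2 j hj

/-- Strictly decreasing the cost of one player strictly decreases the total cost. -/
theorem sum_update_lt_sum {ι M : Type*} [Fintype ι] [DecidableEq ι] {S : ι → Type*}
    [AddCommMonoid M] [PartialOrder M] [IsOrderedCancelAddMonoid M]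
    (Cost : ∀ i, S i → M) (σ : ∀ j, S j) {i : ι} {si : S i} (h : Cost i si < Cost i (σ i)) :
    ∑ j, Cost j (Function.update σ i si j) < ∑ j, Cost j (σ j) := by
  refine Finset.sum_lt_sum (fun j _ => ?_) ⟨i, Finset.mem_univ i, by simpa using h⟩
  rcases eq_or_ne j i with rfl | hj
  · simpa using h.le
  · rw [Function.update_of_ne hj]

/-- Every socially optimal profile is a Nash equilibrium
(`Π_SO ⊆ Π_NE`). -/
theorem socialOptimum_is_nashEquilibrium {N p : ℕ} {S : Fin N → Type*}
    (hne : ∀ i, Nonempty (S i))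
    (Φ : ∀ i, Set (S i)) (Compat : ∀ i j, S i → S j → Prop)
    (hsym : ∀ i j, i ≠ j → ∀ (si : S i) (sj : S j), Compat i j si sj ↔ Compat j i sj si)
    (Cost : ∀ i, S i → Fin p → ℝ) (hCost : ∀ i (si : S i) ℓ, 0 ≤ Cost i si ℓ)
    (σbar : ∀ j, S j) (hSO : SocialOptimum Φ Compat Cost σbar) :
    NashEquilibrium Φ Compat Cost σbar := by
  refine ⟨hSO.1, ?_⟩
  rintro i ⟨si, hsi, hlt⟩
  exact hSO.2 ⟨Function.update σbar i si, hSO.1.update hsym hsi,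
    paretoLt_iff_lt.2 (sum_update_lt_sum Cost σbar (paretoLt_iff_lt.1 hlt))⟩
end

section
/- The price of stability equals one for scalar cost functionals: if p = 1 and σ̄ is a social optimum, then the infimum over all Nash equilibria σ ∈ Π_NE of the total cost Σ_{i=1}^N Cost_i(σ_i) equals the total cost Σ_{i=1}^N Cost_i(σ̄_i) of the social optimum. -/
/-- Nash equilibrium for scalar costs: a jointly feasible profile from which no player
has a feasible unilateral deviation with strictly smaller cost. -/
def NashEquilibriumScalar {N : ℕ} {S : Fin N → Type*} (Φ : ∀ i, Set (S i))
    (Compat : ∀ i j, S i → S j → Prop) (Cost : ∀ i, S i → ℝ)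
    (σbar : ∀ j, S j) : Prop :=
  JointlyFeasible Φ Compat σbar ∧
    ∀ i, ¬ ∃ si : S i, FeasibleAgainst Φ Compat i si σbar ∧ Cost i si < Cost i (σbar i)

/-- Social optimum for scalar costs: a jointly feasible profile with minimal total cost
among jointly feasible profiles. -/
def SocialOptimumScalar {N : ℕ} {S : Fin N → Type*} (Φ : ∀ i, Set (S i))
    (Compat : ∀ i j, S i → S j → Prop) (Cost : ∀ i, S i → ℝ)
    (σbar : ∀ j, S j) : Prop :=
  JointlyFeasible Φ Compat σbar ∧
    ¬ ∃ σ : ∀ j, S j, JointlyFeasible Φ Compat σ ∧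
      ∑ i, Cost i (σ i) < ∑ i, Cost i (σbar i)

/-- A social optimum is a Nash equilibrium. -/
theorem SocialOptimumScalar.nashEquilibriumScalar {N : ℕ} {S : Fin N → Type*}
    {Φ : ∀ i, Set (S i)} {Compat : ∀ i j, S i → S j → Prop}
    (hsym : ∀ i j, i ≠ j → ∀ (si : S i) (sj : S j), Compat i j si sj ↔ Compat j i sj si)
    {Cost : ∀ i, S i → ℝ} {σ : ∀ j, S j} (hσ : SocialOptimumScalar Φ Compat Cost σ) :
    NashEquilibriumScalar Φ Compat Cost σ := by
  refine ⟨hσ.1, fun i ⟨si, hsi, hlt⟩ => hσ.2 ⟨_, hσ.1.update hsym hsi, ?_⟩⟩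
  refine Finset.sum_lt_sum (fun k _ => ?_) ⟨i, Finset.mem_univ i, by simpa using hlt⟩
  rcases eq_or_ne k i with rfl | hk
  · simpa using hlt.le
  · rw [Function.update_of_ne hk]

/-- For scalar cost functionals (`p = 1`), the price of stability
equals one: the infimum over Nash equilibria of the total cost equals the total cost of
a social optimum. -/
theorem priceOfStability_eq_one {N : ℕ} {S : Fin N → Type*}
    (hne : ∀ i, Nonempty (S i))
    (Φ : ∀ i, Set (S i)) (Compat : ∀ i j, S i → S j → Prop)
    (hsym : ∀ i j, i ≠ j → ∀ (si : S i) (sj : S j), Compat i j si sj ↔ Compat j i sj si)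
    (Cost : ∀ i, S i → ℝ) (hCost : ∀ i (si : S i), 0 ≤ Cost i si)
    (σbar : ∀ j, S j) (hSO : SocialOptimumScalar Φ Compat Cost σbar) :
    sInf {c : ℝ | ∃ σ : ∀ j, S j, NashEquilibriumScalar Φ Compat Cost σ ∧
        c = ∑ i, Cost i (σ i)} = ∑ i, Cost i (σbar i) := by
  refine IsLeast.csInf_eq ⟨⟨σbar, hSO.nashEquilibriumScalar hsym, rfl⟩, ?_⟩
  rintro _ ⟨σ, hσ, rfl⟩
  exact not_lt.1 fun hlt => hSO.2 ⟨σ, hσ.1, hlt⟩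
end

section
/- Strong feasibility is preserved under convergence of the other robots' trajectories (Lemma 4): let J be a finite index set and suppose for each j ∈ J the trajectories σ_k^j converge uniformly to σ̄^j as k → ∞. If a trajectory σ is strongly feasible with margin δ > 0 with respect to the family (σ̄^j)_{j∈J}, then there exists T' ≥ 0 such that for all k ≥ T', σ is strongly feasible with margin δ/2 with respect to the family (σ_k^j)_{j∈J}. -/
/-- A trajectory `σ` is strongly feasible with margin `δ` with respect to the family
`σfam` of the other robots' trajectories: there are dynamically feasible trajectories
`σℓ ∈ S` converging uniformly on `[0,∞)` to `σ` and a nonnegative sequence `δℓ → 0`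
such that each `σℓ` stays inside the constraint set `F` with clearance `δℓ`, and `σ`
keeps distance at least `ε + δ` from every trajectory of the family at all times. -/
def StronglyFeasible {n : ℕ} {J : Type*}
    (S : Set (ℝ → EuclideanSpace ℝ (Fin n)))
    (F : Set (EuclideanSpace ℝ (Fin n))) (ε : ℝ)
    (σfam : J → ℝ → EuclideanSpace ℝ (Fin n)) (δ : ℝ)
    (σ : ℝ → EuclideanSpace ℝ (Fin n)) : Prop :=
  (∃ (σℓ : ℕ → ℝ → EuclideanSpace ℝ (Fin n)) (δℓ : ℕ → ℝ),
      (∀ ℓ, σℓ ℓ ∈ S) ∧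
      TendstoUniformlyOn σℓ σ Filter.atTop (Set.Ici 0) ∧
      (∀ ℓ, 0 ≤ δℓ ℓ) ∧
      Filter.Tendsto δℓ Filter.atTop (nhds 0) ∧
      (∀ ℓ, ∀ t ≥ (0 : ℝ), Metric.closedBall (σℓ ℓ t) (δℓ ℓ) ⊆ F)) ∧
  (∀ t ≥ (0 : ℝ), ∀ j, ε + δ ≤ ‖σ t - σfam j t‖)

/-- **Lemma 4.** Strong feasibility is preserved under convergence of the
other robots' trajectories: if `σk j k` converges uniformly on `[0,∞)` to `σbar j` for
each `j` in a finite index set, and `σ` is strongly feasible with margin `δ > 0` with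
respect to `(σbar j)`, then for all sufficiently large `k`, `σ` is strongly feasible with
margin `δ/2` with respect to `(σk j k)`. -/
theorem stronglyFeasible_preserved {n : ℕ} {J : Type*} [Finite J]
    (S : Set (ℝ → EuclideanSpace ℝ (Fin n)))
    (F : Set (EuclideanSpace ℝ (Fin n))) (ε : ℝ) (hε : 0 < ε)
    (σk : J → ℕ → ℝ → EuclideanSpace ℝ (Fin n))
    (σbar : J → ℝ → EuclideanSpace ℝ (Fin n))
    (hconv : ∀ j, TendstoUniformlyOn (σk j) (σbar j) Filter.atTop (Set.Ici 0))
    (σ : ℝ → EuclideanSpace ℝ (Fin n)) (δ : ℝ) (hδ : 0 < δ)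
    (hsf : StronglyFeasible S F ε σbar δ σ) :
    ∃ T' : ℕ, ∀ k ≥ T',
      StronglyFeasible S F ε (fun j => σk j k) (δ / 2) σ := by
  obtain ⟨happrox, hsep⟩ := hsf
  have hclose : ∀ᶠ k in Filter.atTop, ∀ j, ∀ t ∈ Set.Ici (0 : ℝ),
      dist (σbar j t) (σk j k t) < δ / 2 :=
    Filter.eventually_all.2 fun j =>
      Metric.tendstoUniformlyOn_iff.1 (hconv j) (δ / 2) (half_pos hδ)
  obtain ⟨T', hT'⟩ := Filter.eventually_atTop.1 hclose
  refine ⟨T', fun k hk => ⟨happrox, fun t ht j => ?_⟩⟩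
  have hbar := hsep t ht j
  have hdist := hT' k hk j t ht
  have htri := dist_triangle_right (σ t) (σbar j t) (σk j k t)
  rw [← dist_eq_norm] at hbar ⊢
  linarith
end
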